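/- The span of the ten vector fields X₁,…,X₁₀ defined in coordinates (t,x,u,f,g) by X₁=∂_t, X₂=∂_x, X₃=∂_u, X₄=t∂_t-f∂_f-g∂_g, X₅=x∂_t-fg∂_f-g²∂_g, X₆=u∂_t-f²∂_f-fg∂_g, X₇=x∂_x+g∂_g, X₈=u∂_x+f∂_g, X₉=x∂_u+g∂_f, X₁₀=u∂_u+f∂_f is closed under Lie bracket (i.e., forms a Lie algebra). -/

import Mathlib

noncomputable section

/-- Coordinates `(t, x, u, f, g)` on `ℝ⁵`. -/
abbrev P5 : Type := ℝ × ℝ × ℝ × ℝ × ℝ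

/-- Action of a vector field `X` on a smooth function `h`. -/
def act (X : P5 → P5) (h : P5 → ℝ) : P5 → ℝ := fun p => fderiv ℝ h p (X p)

/-- The ten vector fields `X₁, …, X₁₀` of the equivalence algebra. -/
def XX : Fin 10 → P5 → P5 :=
  ![fun _ => (1, 0, 0, 0, 0),                                              -- X₁ = ∂t
    fun _ => (0, 1, 0, 0, 0),                                              -- X₂ = ∂x
    fun _ => (0, 0, 1, 0, 0),                                              -- X₃ = ∂u
    fun p => (p.1, 0, 0, -p.2.2.2.1, -p.2.2.2.2),                          -- X₄
    fun p => (p.2.1, 0, 0, -(p.2.2.2.1 * p.2.2.2.2), -p.2.2.2.2 ^ 2),      -- X₅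
    fun p => (p.2.2.1, 0, 0, -p.2.2.2.1 ^ 2, -(p.2.2.2.1 * p.2.2.2.2)),    -- X₆
    fun p => (0, p.2.1, 0, 0, p.2.2.2.2),                                  -- X₇
    fun p => (0, p.2.2.1, 0, 0, p.2.2.2.1),                                -- X₈
    fun p => (0, 0, p.2.1, p.2.2.2.2, 0),                                  -- X₉
    fun p => (0, 0, p.2.2.1, p.2.2.2.1, 0)]                                -- X₁₀

/-- Explicit derivative of `XX i` at `p` in the direction `v`. -/
def DX : Fin 10 → P5 → P5 → P5 :=
  ![fun _ _ => (0, 0, 0, 0, 0),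
    fun _ _ => (0, 0, 0, 0, 0),
    fun _ _ => (0, 0, 0, 0, 0),
    fun _ v => (v.1, 0, 0, -v.2.2.2.1, -v.2.2.2.2),
    fun p v => (v.2.1, 0, 0, -(p.2.2.2.1 * v.2.2.2.2 + p.2.2.2.2 * v.2.2.2.1),
      -(2 * p.2.2.2.2 * v.2.2.2.2)),
    fun p v => (v.2.2.1, 0, 0, -(2 * p.2.2.2.1 * v.2.2.2.1),
      -(p.2.2.2.1 * v.2.2.2.2 + p.2.2.2.2 * v.2.2.2.1)),
    fun _ v => (0, v.2.1, 0, 0, v.2.2.2.2),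
    fun _ v => (0, v.2.2.1, 0, 0, v.2.2.2.1),
    fun _ v => (0, 0, v.2.1, v.2.2.2.2, 0),
    fun _ v => (0, 0, v.2.2.1, v.2.2.2.1, 0)]

lemma XX_diff (i : Fin 10) : Differentiable ℝ (XX i) := by
  fin_cases i <;> simp only [XX] <;> dsimp <;> fun_prop

lemma XX_fderiv (i : Fin 10) (p v : P5) : fderiv ℝ (XX i) p v = DX i p v := by
  have key : HasDerivAt (fun s : ℝ => XX i (p + s • v)) (DX i p v) 0 := by
    have lin : ∀ a b : ℝ, HasDerivAt (fun s : ℝ => a + s * b) b 0 := fun a b => by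
      simpa using ((hasDerivAt_id (0 : ℝ)).mul_const b).const_add a
    have ml : ∀ a b c d : ℝ, HasDerivAt (fun s : ℝ => -((a + s * b) * (c + s * d)))
        (-(a * d + c * b)) 0 := fun a b c d => by
      refine ((lin a b).mul (lin c d)).neg.congr_deriv ?_
      ring
    have sq : ∀ a b : ℝ, HasDerivAt (fun s : ℝ => -(a + s * b) ^ 2) (-(2 * a * b)) 0 :=
      fun a b => by
      refine ((lin a b).pow 2).neg.congr_deriv ?_
      simp
    have z : ∀ a : ℝ, HasDerivAt (fun _ : ℝ => a) 0 0 := fun a => hasDerivAt_const _ _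
    have ng : ∀ a b : ℝ, HasDerivAt (fun s : ℝ => -(a + s * b)) (-b) 0 := fun a b => (lin a b).neg
    fin_cases i <;>
      refine HasDerivAt.prodMk ?_ (HasDerivAt.prodMk ?_ (HasDerivAt.prodMk ?_
        (HasDerivAt.prodMk ?_ ?_))) <;>
      first
        | exact z _
        | exact lin _ _
        | exact ng _ _
        | exact ml _ _ _ _
        | exact sq _ _
  have h2 : HasDerivAt (fun s : ℝ => XX i (p + s • v)) (fderiv ℝ (XX i) p v) 0 := by
    have h3 : HasDerivAt (fun s : ℝ => p + s • v) v 0 := by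
      simpa using ((hasDerivAt_id (0 : ℝ)).smul_const v).const_add p
    have h4 : HasFDerivAt (XX i) (fderiv ℝ (XX i) p) (p + (0 : ℝ) • v) := by
      simpa using (XX_diff i p).hasFDerivAt
    exact h4.comp_hasDerivAt 0 h3
  exact h2.unique key

/-- Components of the Lie bracket `[XX i, XX j]`. -/
def VV (i j : Fin 10) (p : P5) : P5 := DX j p (XX i p) - DX i p (XX j p)

/-- Structure constants, read off from the affine `(t, x, u)` part of the bracket. -/
def CC (i j : Fin 10) : Fin 10 → ℝ :=
  ![(VV i j 0).1, (VV i j 0).2.1, (VV i j 0).2.2.1,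
    (VV i j (1, 0, 0, 0, 0)).1 - (VV i j 0).1,
    (VV i j (0, 1, 0, 0, 0)).1 - (VV i j 0).1,
    (VV i j (0, 0, 1, 0, 0)).1 - (VV i j 0).1,
    (VV i j (0, 1, 0, 0, 0)).2.1 - (VV i j 0).2.1,
    (VV i j (0, 0, 1, 0, 0)).2.1 - (VV i j 0).2.1,
    (VV i j (0, 1, 0, 0, 0)).2.2.1 - (VV i j 0).2.2.1,
    (VV i j (0, 0, 1, 0, 0)).2.2.1 - (VV i j 0).2.2.1]

set_option maxHeartbeats 4000000 in
lemma VV_eq (i j : Fin 10) (p : P5) : VV i j p = ∑ k : Fin 10, CC i j k • XX k p := by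
  obtain ⟨t, x, u, f, g⟩ := p
  fin_cases i <;> fin_cases j <;>
    simp [Fin.sum_univ_succ, CC, VV, DX, XX] <;> (try ring_nf) <;> (try simp) <;> (try rfl)

lemma act_act (i j : Fin 10) (h : P5 → ℝ) (hh : ContDiff ℝ (⊤ : ℕ∞) h) (p : P5) :
    act (XX i) (act (XX j) h) p
      = fderiv ℝ (fderiv ℝ h) p (XX i p) (XX j p) + fderiv ℝ h p (DX j p (XX i p)) := by
  have hd : DifferentiableAt ℝ (fderiv ℝ h) p :=
    ((hh.fderiv_right (m := 1) (by norm_cast)).differentiable (by norm_num)) p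
  have := (hd.hasFDerivAt.clm_apply (XX_diff j p).hasFDerivAt).fderiv
  unfold act
  rw [this]
  simp [XX_fderiv, add_comm]

/-- The span of `X₁, …, X₁₀` is closed under the Lie bracket: every pairwise
bracket is a real linear combination of `X₁, …, X₁₀`. -/
theorem span_closed_under_bracket :
    ∀ i j : Fin 10, ∃ c : Fin 10 → ℝ,
      ∀ h : P5 → ℝ, ContDiff ℝ (⊤ : ℕ∞) h → ∀ p : P5,
        act (XX i) (act (XX j) h) p - act (XX j) (act (XX i) h) p
          = ∑ k : Fin 10, c k * act (XX k) h p := by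
  intro i j
  refine ⟨CC i j, fun h hh p => ?_⟩
  have hs : fderiv ℝ (fderiv ℝ h) p (XX i p) (XX j p)
      = fderiv ℝ (fderiv ℝ h) p (XX j p) (XX i p) :=
    (hh.contDiffAt.isSymmSndFDerivAt (by simp; norm_cast)) _ _
  have hv : ∑ k : Fin 10, CC i j k * act (XX k) h p = fderiv ℝ h p (VV i j p) := by
    rw [VV_eq, map_sum]
    simp [act]
  rw [hv, act_act i j h hh, act_act j i h hh, hs, VV, map_sub]
  ring

end
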